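/- Sample size, Table 1 row 3 (bound): Let c_0 ≥ 1 and c ≥ 2 be integers and suppose the component designs satisfy #X_{i,j} = c_0·(c^j − 1) for all i = 1,…,d and all j ≥ 1. Then #X_SG(η) ≤ c_0^d · (c−1)^{d−1} · c^{η−d+1} · binom(η−1, d−1). -/

import Mathlib

open Finset

noncomputable section

/-- Multi-indices `j ∈ ℕ^d` with all entries at least 1 and `∑ j i = η`. -/
def idxE (d η : ℕ) : Finset (Fin d → ℕ) :=
  (Fintype.piFinset fun _ : Fin d => Finset.Icc 1 η).filter fun j => ∑ i, j i = η

/-- The lattice design `X_{1,j_1} × ⋯ × X_{d,j_d}`. -/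
def lattice {d : ℕ} (X : Fin d → ℕ → Finset ℝ) (j : Fin d → ℕ) : Finset (Fin d → ℝ) :=
  Fintype.piFinset fun i => X i (j i)

/-- The sparse grid design `X_SG(η)`. -/
def sparseGrid {d : ℕ} (X : Fin d → ℕ → Finset ℝ) (η : ℕ) : Finset (Fin d → ℝ) :=
  (idxE d η).biUnion fun j => lattice X j

lemma mem_idxE {d η : ℕ} {j : Fin d → ℕ} :
    j ∈ idxE d η ↔ (∀ i, 1 ≤ j i) ∧ ∑ i, j i = η := by
  simp only [idxE, mem_filter, Fintype.mem_piFinset, Finset.mem_Icc]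
  refine ⟨fun h => ⟨fun i => (h.1 i).1, h.2⟩, fun h => ⟨fun i => ⟨h.1 i, ?_⟩, h.2⟩⟩
  rw [← h.2]
  exact single_le_sum (f := j) (fun _ _ => Nat.zero_le _) (mem_univ i)

lemma card_idxE_le {d η : ℕ} (hd : 1 ≤ d) (hη : d ≤ η) :
    (idxE d η).card ≤ (η - 1).choose (d - 1) := by
  have hcard : ((univ : Finset (Fin d)).finsuppAntidiag (η - d)).card =
      (η - 1).choose (d - 1) := by
    rw [card_finsuppAntidiag_nat_eq_choose, card_univ, Fintype.card_fin,
      show d + (η - d) - 1 = η - 1 by omega]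
    exact Nat.choose_symm_of_eq_add (by omega)
  rw [← hcard]
  refine card_le_card_of_injOn
    (fun j => Finsupp.equivFunOnFinite.symm fun i => j i - 1) ?_ ?_
  · intro j hj
    obtain ⟨hpos, hsum⟩ := mem_idxE.1 hj
    simp only [mem_coe, mem_finsuppAntidiag,
      Finsupp.equivFunOnFinite_symm_apply_apply, subset_univ, and_true]
    have h : ∑ i, (j i - 1) + d = η := by
      calc ∑ i, (j i - 1) + d = ∑ i, (j i - 1 + 1) := by simp [sum_add_distrib]
        _ = ∑ i, j i := sum_congr rfl fun i _ => Nat.sub_add_cancel (hpos i)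
        _ = η := hsum
    omega
  · intro j hj k hk hjk
    have h := Finsupp.equivFunOnFinite.symm.injective hjk
    funext i
    have hi : j i - 1 = k i - 1 := congrFun h i
    have := (mem_idxE.1 hj).1 i
    have := (mem_idxE.1 hk).1 i
    omega

/-- The lattice design of `k` with every component but the first restricted to the points that
are new at its level. -/
def slab {n : ℕ} (X : Fin (n + 1) → ℕ → Finset ℝ) (k : Fin (n + 1) → ℕ) :
    Finset (Fin (n + 1) → ℝ) :=
  Fintype.piFinset
    (Fin.cons (X 0 (k 0)) fun i : Fin n => X i.succ (k i.succ) \ X i.succ (k i.succ - 1))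

lemma mem_slab {n : ℕ} {X : Fin (n + 1) → ℕ → Finset ℝ} {k : Fin (n + 1) → ℕ}
    {x : Fin (n + 1) → ℝ} :
    x ∈ slab X k ↔ x 0 ∈ X 0 (k 0) ∧
      ∀ i : Fin n, x i.succ ∈ X i.succ (k i.succ) \ X i.succ (k i.succ - 1) := by
  simp only [slab, Fintype.mem_piFinset, Fin.forall_fin_succ, Fin.cons_zero, Fin.cons_succ]

lemma card_slab {n : ℕ} (X : Fin (n + 1) → ℕ → Finset ℝ) (k : Fin (n + 1) → ℕ) :
    (slab X k).card = (X 0 (k 0)).card *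
      ∏ i : Fin n, (X i.succ (k i.succ) \ X i.succ (k i.succ - 1)).card := by
  simp only [slab, Fintype.card_piFinset, Fin.prod_univ_succ, Fin.cons_zero, Fin.cons_succ]

/-- In a nested sequence starting from `∅`, every point is new at some first level. -/
lemma exists_level_mem_sdiff {α : Type*} [DecidableEq α] {A : ℕ → Finset α} (h0 : A 0 = ∅)
    {m : ℕ} {a : α} (ha : a ∈ A m) : ∃ l, 1 ≤ l ∧ l ≤ m ∧ a ∈ A l \ A (l - 1) := by
  classical
  have hex : ∃ l, a ∈ A l := ⟨m, ha⟩
  have hpos : 1 ≤ Nat.find hex := by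
    rw [Nat.one_le_iff_ne_zero]
    intro h
    have := Nat.find_spec hex
    simp [h, h0] at this
  exact ⟨Nat.find hex, hpos, Nat.find_min' hex ha,
    mem_sdiff.2 ⟨Nat.find_spec hex, Nat.find_min hex (by omega)⟩⟩

lemma sparseGrid_subset_biUnion_slab {n η : ℕ} {X : Fin (n + 1) → ℕ → Finset ℝ}
    (hX0 : ∀ i, X i 0 = ∅) (hnest : ∀ i j, X i j ⊆ X i (j + 1)) :
    sparseGrid X η ⊆ (idxE (n + 1) η).biUnion (slab X) := by
  intro x hx
  obtain ⟨j, hj, hxj⟩ := mem_biUnion.1 hx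
  obtain ⟨hpos, hsum⟩ := mem_idxE.1 hj
  have hxj : ∀ i, x i ∈ X i (j i) := Fintype.mem_piFinset.1 hxj
  choose l hl1 hlj hl using fun i : Fin n => exists_level_mem_sdiff (hX0 i.succ) (hxj i.succ)
  rw [Fin.sum_univ_succ] at hsum
  have hle : ∑ i, l i ≤ ∑ i : Fin n, j i.succ := sum_le_sum fun i _ => hlj i
  have hj0 : j 0 ≤ η - ∑ i, l i := by omega
  refine mem_biUnion.2 ⟨Fin.cons (η - ∑ i, l i) l, mem_idxE.2 ⟨?_, ?_⟩, mem_slab.2 ⟨?_, ?_⟩⟩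
  · exact Fin.forall_fin_succ.2 ⟨by simpa using (hpos 0).trans hj0, by simpa using hl1⟩
  · simp only [Fin.sum_univ_succ, Fin.cons_zero, Fin.cons_succ]
    omega
  · exact monotone_nat_of_le_succ (hnest 0) hj0 (hxj 0)
  · simpa only [Fin.cons_succ] using hl

lemma card_sdiff_pred {A : ℕ → Finset ℝ} (h0 : A 0 = ∅) (hnest : ∀ j, A j ⊆ A (j + 1))
    {c₀ c : ℕ} (hc : 2 ≤ c) (hcard : ∀ j, 1 ≤ j → (A j).card = c₀ * (c ^ j - 1))
    {m : ℕ} (hm : 1 ≤ m) : (A m \ A (m - 1)).card = c₀ * (c - 1) * c ^ (m - 1) := by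
  have hall : ∀ j, (A j).card = c₀ * (c ^ j - 1) := fun j => by
    rcases Nat.eq_zero_or_pos j with rfl | hj
    · simp [h0]
    · exact hcard j hj
  obtain ⟨m, rfl⟩ := Nat.exists_eq_add_of_le' hm
  rw [Nat.add_sub_cancel, card_sdiff_of_subset (hnest m), hall, hall, ← Nat.mul_sub, mul_assoc,
    Nat.sub_mul, one_mul, pow_succ']
  have : 1 ≤ c ^ m := Nat.one_le_pow _ _ (by omega)
  congr 1
  omega

lemma card_slab_le {n η : ℕ} {X : Fin (n + 1) → ℕ → Finset ℝ}
    (hX0 : ∀ i, X i 0 = ∅) (hnest : ∀ i j, X i j ⊆ X i (j + 1)) {c₀ c : ℕ} (hc : 2 ≤ c)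
    (hcard : ∀ (i : Fin (n + 1)) (j : ℕ), 1 ≤ j → (X i j).card = c₀ * (c ^ j - 1))
    {k : Fin (n + 1) → ℕ} (hk : k ∈ idxE (n + 1) η) :
    (slab X k).card ≤ c₀ ^ (n + 1) * (c - 1) ^ n * c ^ (η - n) := by
  obtain ⟨hpos, hsum⟩ := mem_idxE.1 hk
  have hexp : k 0 + ∑ i : Fin n, (k i.succ - 1) = η - n := by
    have h : ∑ i : Fin n, (k i.succ - 1) + n = ∑ i : Fin n, k i.succ := by
      calc ∑ i : Fin n, (k i.succ - 1) + n = ∑ i : Fin n, (k i.succ - 1 + 1) := by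
            simp [sum_add_distrib]
        _ = _ := sum_congr rfl fun i _ => Nat.sub_add_cancel (hpos _)
    rw [Fin.sum_univ_succ] at hsum
    omega
  rw [card_slab, hcard 0 _ (hpos 0), prod_congr rfl fun (i : Fin n) _ =>
    card_sdiff_pred (hX0 i.succ) (hnest i.succ) hc (hcard i.succ) (hpos i.succ),
    prod_mul_distrib, prod_const, card_univ, Fintype.card_fin, prod_pow_eq_pow_sum]
  calc c₀ * (c ^ k 0 - 1) * ((c₀ * (c - 1)) ^ n * c ^ ∑ i : Fin n, (k i.succ - 1))
      ≤ c₀ * c ^ k 0 * ((c₀ * (c - 1)) ^ n * c ^ ∑ i : Fin n, (k i.succ - 1)) := by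
        gcongr
        exact Nat.sub_le _ _
    _ = c₀ ^ (n + 1) * (c - 1) ^ n * c ^ (k 0 + ∑ i : Fin n, (k i.succ - 1)) := by
        rw [mul_pow, pow_add]
        ring
    _ = _ := by rw [hexp]

/-- Sample size, Table 1 row 3 (bound): if `#X_{i,j} = c₀·(c^j − 1)` then
`#X_SG(η) ≤ c₀^d (c−1)^{d−1} c^{η−d+1} · C(η−1, d−1)`. -/
theorem sample_size_row3_bound (d η : ℕ) (hd : 1 ≤ d) (hη : d ≤ η)
    (X : Fin d → ℕ → Finset ℝ) (hX0 : ∀ i, X i 0 = ∅)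
    (hnest : ∀ i j, X i j ⊆ X i (j + 1))
    (c₀ c : ℕ) (hc₀ : 1 ≤ c₀) (hc : 2 ≤ c)
    (hcard : ∀ (i : Fin d) (j : ℕ), 1 ≤ j → (X i j).card = c₀ * (c ^ j - 1)) :
    (sparseGrid X η).card ≤
      c₀ ^ d * (c - 1) ^ (d - 1) * c ^ (η - d + 1) * (η - 1).choose (d - 1) := by
  obtain ⟨n, rfl⟩ := Nat.exists_eq_add_of_le' hd
  calc (sparseGrid X η).card
      ≤ ((idxE (n + 1) η).biUnion (slab X)).card :=
        card_le_card (sparseGrid_subset_biUnion_slab hX0 hnest)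
    _ ≤ (idxE (n + 1) η).card * (c₀ ^ (n + 1) * (c - 1) ^ n * c ^ (η - n)) :=
        card_biUnion_le_card_mul _ _ _ fun _ hk => card_slab_le hX0 hnest hc hcard hk
    _ ≤ (η - 1).choose (n + 1 - 1) * (c₀ ^ (n + 1) * (c - 1) ^ n * c ^ (η - n)) :=
        Nat.mul_le_mul_right _ (card_idxE_le hd hη)
    _ = _ := by
        rw [mul_comm, Nat.add_sub_cancel, show η - (n + 1) + 1 = η - n by omega]
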